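/- With the hypotheses of the Askey–Wilson setting below, assume moreover that z_i = z_1·q^{2−2i} for 1 ≤ i ≤ d, that a ≠ a′·q^{2d+2}, and that a′ ≠ a·q^{2d+2}. Then x_i = (b + b′)·q^{d−2i} − a′·q^{1−2i}(q^{d+1} + q^{−d−1} − q^{d−2i−1} − q^{d−2i+1})·z_1 for 0 ≤ i ≤ d, and y_i = q^{d−1}(q^i − q^{−i})(q^{i−d−1} − q^{d−i+1})(b + a′·z_1·q^{2−2i})(b′ + a′·z_1·q^{2−2i})·z_1^{−1} for 1 ≤ i ≤ d. -/

import Mathlib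

/-- A solution of the recurrence obtained from the entries `(i + 2, i)` of the first
Askey–Wilson relation is a combination of `s ^ i`, `s ^ (-i)`, `s ^ (-2 i)`. -/
theorem exists_diag_closed_form {F : Type*} [Field F] {s u v Z : F} (hs : s ≠ 0)
    (hs1 : s - 1 ≠ 0) (hs2 : s + 1 ≠ 0) {d : ℕ} {x : ℕ → F}
    (hx : ∀ i, i + 2 ≤ d →
      Z / s ^ (i + 2) * ((u * s ^ (i + 1) + v / s ^ (i + 1)) + (u * s ^ i + v / s ^ i)
          - (s + s⁻¹) * (u * s ^ (i + 2) + v / s ^ (i + 2)))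
        + Z / s ^ (i + 1) * ((u * s ^ (i + 2) + v / s ^ (i + 2))
          + (u * s ^ (i + 1) + v / s ^ (i + 1)) - (s + s⁻¹) * (u * s ^ i + v / s ^ i))
        + x i - (s + s⁻¹) * x (i + 1) + x (i + 2) = 0) :
    ∃ α γ : F, ∀ i ≤ d,
      x i = α * s ^ i + γ / s ^ i + Z * v * (1 + s) / s / (s ^ i) ^ 2 := by
  set c : F := Z * v * (1 + s) / s with hc
  refine ⟨(s * (x 1 - c / s ^ 2) - (x 0 - c)) / ((s - 1) * (s + 1)),
    (s ^ 2 * (x 0 - c) - s * (x 1 - c / s ^ 2)) / ((s - 1) * (s + 1)), ?_⟩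
  intro i
  induction i using Nat.twoStepInduction with
  | zero => intro _; field_simp; ring
  | one => intro _; field_simp; ring
  | more i h0 h1 =>
    intro hi
    have e0 := h0 (by lia)
    have e1 := h1 (by lia)
    have e2 := hx i hi
    rw [e0, e1] at e2
    have ht : s ^ i ≠ 0 := pow_ne_zero _ hs
    simp only [pow_succ, pow_zero, one_mul] at e2 ⊢
    rw [← sub_eq_zero]
    rw [← e2, hc]
    generalize s ^ i = t at *
    field_simp
    ring

/-- A solution of the recurrence obtained from the entries `(i + 1, i)` of the first
Askey–Wilson relation is a Laurent polynomial in `s ^ i`. -/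
theorem exists_superdiag_closed_form {F : Type*} [Field F] {s u v Z α γ ω : F} (hs : s ≠ 0)
    (hs1 : s - 1 ≠ 0) (hs2 : s + 1 ≠ 0) {d : ℕ} {x y : ℕ → F}
    (hx : ∀ i ≤ d, x i = α * s ^ i + γ / s ^ i + Z * v * (1 + s) / s / (s ^ i) ^ 2)
    (hy : ∀ i, i + 1 ≤ d →
      x i * ((u * s ^ i + v / s ^ i) + (u * s ^ (i + 1) + v / s ^ (i + 1))
          - (s + s⁻¹) * (u * s ^ i + v / s ^ i))
        + x (i + 1) * ((u * s ^ i + v / s ^ i) + (u * s ^ (i + 1) + v / s ^ (i + 1))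
          - (s + s⁻¹) * (u * s ^ (i + 1) + v / s ^ (i + 1)))
        + y i - (s + s⁻¹) * y (i + 1) + y (i + 2) = ω) :
    ∃ A B : F, ∀ i ≤ d + 1,
      y i = A * s ^ i + B / s ^ i + (-(α * v + γ * u) - ω * s / (s - 1) ^ 2)
        + α * u / s * (s ^ i) ^ 2 + γ * v * s / (s ^ i) ^ 2 + Z * v ^ 2 * s / (s ^ i) ^ 3 := by
  set C : F := -(α * v + γ * u) - ω * s / (s - 1) ^ 2 with hC
  set y0 : F := y 0 - (C + α * u / s + γ * v * s + Z * v ^ 2 * s) with hy0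
  set y1 : F := y 1 - (C + α * u / s * s ^ 2 + γ * v * s / s ^ 2 + Z * v ^ 2 * s / s ^ 3)
    with hy1
  refine ⟨(s * y1 - y0) / ((s - 1) * (s + 1)), (s ^ 2 * y0 - s * y1) / ((s - 1) * (s + 1)), ?_⟩
  intro i
  induction i using Nat.twoStepInduction with
  | zero => intro _; simp only [hy0, pow_zero]; field_simp; ring
  | one => intro _; simp only [hy1, pow_one]; field_simp; ring
  | more i h0 h1 =>
    intro hi
    have e0 := h0 (by lia)
    have e1 := h1 (by lia)
    have e2 := hy i (by lia)
    rw [e0, e1, hx i (by lia), hx (i + 1) (by lia)] at e2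
    have ht : s ^ i ≠ 0 := pow_ne_zero _ hs
    clear_value y0 y1
    simp only [pow_succ, pow_zero, one_mul] at e2 ⊢
    rw [← sub_eq_zero] at e2 ⊢
    rw [← e2, hC]
    generalize s ^ i = t at *
    field_simp
    ring

/-- The entries `(i + 1, i)` of the second Askey–Wilson relation force the leading coefficient
of the diagonal to vanish and determine the leading coefficient of the superdiagonal. -/
theorem leading_coeffs {F : Type*} [Field F] {s u v Z α γ A B C r : F} (hs : s ≠ 0)
    (hs1 : s - 1 ≠ 0) (hs2 : s + 1 ≠ 0) (hs3 : s ^ 3 - 1 ≠ 0) (hZ : Z ≠ 0)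
    (huv : u ≠ 0 ∨ v ≠ 0) {d : ℕ} (hd : 3 ≤ d) {x y : ℕ → F}
    (hx : ∀ i ≤ d, x i = α * s ^ i + γ / s ^ i + Z * v * (1 + s) / s / (s ^ i) ^ 2)
    (hy : ∀ i ≤ d + 1, y i = A * s ^ i + B / s ^ i + C
        + α * u / s * (s ^ i) ^ 2 + γ * v * s / (s ^ i) ^ 2 + Z * v ^ 2 * s / (s ^ i) ^ 3)
    (hS : ∀ i, i + 1 ≤ d →
      x (i + 1) ^ 2 - (s + s⁻¹) * x (i + 1) * x i + x i ^ 2 + r * (s - s⁻¹) ^ 2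
        + Z / s ^ (i + 1) * (-(y i * (1 + s⁻¹)) + y (i + 1) * (2 + (s + s⁻¹))
          - y (i + 2) * (1 + s)) = 0) :
    α = 0 ∧ A * Z = r := by
  have key : ∀ i, i + 1 ≤ d →
      -(Z * α * u / s * (1 + s) * (s ^ 2 - 1) * (1 - (s ^ 3)⁻¹)) * (s ^ (i + 1)) ^ 2
        + ((r - α * γ - A * Z) * (s - s⁻¹) ^ 2) * s ^ (i + 1)
        - (α * (Z * v * (1 + s) / s) * (s ^ 3 - 1) * (s ^ 2 - 1) / s ^ 2) = 0 := by
    intro i hi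
    have e := hS i hi
    rw [hx i (by lia), hx (i + 1) hi, hy i (by lia), hy (i + 1) (by lia), hy (i + 2) (by lia)] at e
    have ht : s ^ i ≠ 0 := pow_ne_zero _ hs
    simp only [pow_succ, pow_zero, one_mul] at e ⊢
    rw [← zero_mul (s ^ i * s), ← e]
    generalize s ^ i = t at *
    field_simp
    ring
  have k1 := key 0 (by lia)
  have k2 := key 1 (by lia)
  have k3 := key 2 (by lia)
  set P := -(Z * α * u / s * (1 + s) * (s ^ 2 - 1) * (1 - (s ^ 3)⁻¹)) with hP
  set K := (r - α * γ - A * Z) * (s - s⁻¹) ^ 2 with hK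
  set R := α * (Z * v * (1 + s) / s) * (s ^ 3 - 1) * (s ^ 2 - 1) / s ^ 2 with hR
  have hP0 : P = 0 := by
    have : P * (s ^ 3 * ((s - 1) * (s - 1) * (s + 1))) = 0 := by
      linear_combination k3 - (1 + s) * k2 + s * k1
    simpa [hs, hs1, hs2] using this
  have hK0 : K = 0 := by
    rw [hP0] at k1 k2
    have : K * (s * (s - 1)) = 0 := by linear_combination k2 - k1
    simpa [hs, hs1] using this
  have hR0 : R = 0 := by
    rw [hP0, hK0] at k1
    linear_combination -k1
  have hs21 : s ^ 2 - 1 ≠ 0 := by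
    rw [show s ^ 2 - 1 = (s - 1) * (s + 1) by ring]; exact mul_ne_zero hs1 hs2
  have hs3' : 1 - (s ^ 3)⁻¹ ≠ 0 := by
    intro h
    apply hs3
    field_simp at h
    simpa using h
  have hs2' : 1 + s ≠ 0 := by rwa [add_comm]
  have hα : α = 0 := by
    rcases huv with h | h
    · simpa [hP, hs, hs21, hs3', hs2', hZ, h] using hP0
    · simpa [hR, hs, hs21, hs3, hs2', hZ, h] using hR0
  refine ⟨hα, ?_⟩
  have hss : s - s⁻¹ ≠ 0 := by
    intro h
    apply hs21
    field_simp at h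
    linear_combination h
  have : r - α * γ - A * Z = 0 := by simpa [hK, hss] using hK0
  rw [hα] at this
  linear_combination -this

/-- The boundary conditions on the superdiagonal together with the entry `(0, 0)` of the first
Askey–Wilson relation determine the remaining coefficients. -/
theorem boundary_coeffs {F : Type*} [Field F] {s T D a a' b b' X Z g A B C ω η : F}
    (hs : s ≠ 0) (hs1 : s - 1 ≠ 0) (hs2 : s + 1 ≠ 0) (hD : D ≠ 0) (hTD : T = s * D ^ 2)
    (hT1 : T - 1 ≠ 0) (hT2 : T + 1 ≠ 0) (hZ : Z ≠ 0)
    (hne : a - a' * T ≠ 0) (hne' : a' - a * T ≠ 0) (hA : A * Z = b * b')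
    (hω : ω = (s - 1) ^ 2 / s * ((T + 1) * X - (a + a') * (b + b')))
    (hη : η = -((s - 1) ^ 2 / s * (s + 1) * D *
      ((a + a') * X - a * a' * (b + b') * ((T + 1) / T))))
    (hC : C = -(g * a) - ω * s / (s - 1) ^ 2)
    (h0 : A + B + C + g * a' * T + Z * a' ^ 2 * T = 0)
    (hT : A * T + B / T + C + g * a' * T / T ^ 2 + Z * a' ^ 2 * T / T ^ 3 = 0)
    (h00 : (g * D + Z * a' * D * (1 + s) / s) * ((2 - (s + s⁻¹)) * (a / D + a' * D) ^ 2
        + a * a' * (s - s⁻¹) ^ 2)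
      + (A * s + B / s + C + g * a' * T / s ^ 2 + Z * a' ^ 2 * T / s ^ 3) *
        ((a / D + a' * D) + (a / D * s + a' * D / s) - (s + s⁻¹) * (a / D + a' * D))
      = ω * (a / D + a' * D) + η) :
    g = b + b' - a' * Z * (1 + T⁻¹) ∧
    B = A * T - g * a' * (T + 1) - Z * a' ^ 2 * (T ^ 2 + T + 1) / T ∧
    C = -A - B - g * a' * T - Z * a' ^ 2 * T := by
  have hT0 : T ≠ 0 := by rw [hTD]; positivity
  have hCe : C = -A - B - g * a' * T - Z * a' ^ 2 * T := by linear_combination h0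
  have hBe : B = A * T - g * a' * (T + 1) - Z * a' ^ 2 * (T ^ 2 + T + 1) / T := by
    have : (B - (A * T - g * a' * (T + 1) - Z * a' ^ 2 * (T ^ 2 + T + 1) / T)) * (T - 1) = 0 := by
      rw [hCe] at hT
      rw [← neg_eq_zero, ← mul_zero T, ← hT]
      field_simp
      ring
    rcases mul_eq_zero.1 this with h | h
    · linear_combination h
    · exact absurd h hT1
  refine ⟨?_, hBe, hCe⟩
  have hX : X = ((a + a') * (b + b') - g * a - C) / (T + 1) := by
    rw [hC, hω]
    field_simp
    ring
  have hAe : A = b * b' / Z := by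
    field_simp
    exact hA
  have hmain : (g - (b + b' - a' * Z * (1 + T⁻¹))) * ((a - a' * T) * (a' - a * T)) = 0 := by
    rw [hη, hω, hX, hCe, hBe, hAe] at h00
    subst hTD
    have hT2' : 1 + s * D ^ 2 ≠ 0 := by rwa [add_comm]
    have hk : (s - 1) ^ 2 * (s + 1) * D / (s * (s * D ^ 2) * (s * D ^ 2 + 1)) ≠ 0 := by
      positivity
    refine (mul_eq_zero.1 ?_).resolve_left hk
    rw [← sub_eq_zero] at h00
    rw [← h00]
    field_simp
    ring
  have := (mul_eq_zero.1 hmain).resolve_right (mul_ne_zero hne hne')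
  linear_combination this

/-- The entry of a matrix at integer indices, with value `0` outside of the matrix. -/
def Matrix.intEntry {F : Type*} [Zero F] {d : ℕ} (M : Matrix (Fin (d + 1)) (Fin (d + 1)) F)
    (i j : ℤ) : F :=
  if h : (0 ≤ i ∧ i ≤ d) ∧ 0 ≤ j ∧ j ≤ d then
    M ⟨i.toNat, by lia⟩ ⟨j.toNat, by lia⟩ else 0

namespace Matrix

variable {F : Type*} [Field F] {d : ℕ} (M N : Matrix (Fin (d + 1)) (Fin (d + 1)) F)

theorem intEntry_natCast {i j : ℕ} (hi : i ≤ d) (hj : j ≤ d) :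
    M.intEntry i j = M ⟨i, by lia⟩ ⟨j, by lia⟩ := by
  simp [intEntry, hi, hj]

theorem intEntry_val (i j : Fin (d + 1)) : M.intEntry (i : ℕ) (j : ℕ) = M i j :=
  intEntry_natCast M (by lia) (by lia)

theorem intEntry_eq_zero_of_row {i : ℤ} (h : i < 0 ∨ d < i) (j : ℤ) : M.intEntry i j = 0 :=
  dif_neg (by lia)

theorem intEntry_add (i j : ℤ) : (M + N).intEntry i j = M.intEntry i j + N.intEntry i j := by
  unfold intEntry; split_ifs <;> simp

theorem intEntry_sub (i j : ℤ) : (M - N).intEntry i j = M.intEntry i j - N.intEntry i j := by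
  unfold intEntry; split_ifs <;> simp

theorem intEntry_smul (c : F) (i j : ℤ) : (c • M).intEntry i j = c * M.intEntry i j := by
  unfold intEntry; split_ifs <;> simp

theorem intEntry_one_self {i : ℤ} (h0 : 0 ≤ i) (hd : i ≤ d) :
    (1 : Matrix (Fin (d + 1)) (Fin (d + 1)) F).intEntry i i = 1 := by
  simp [intEntry, h0, hd]

theorem intEntry_one_of_ne {i j : ℤ} (h : i ≠ j) :
    (1 : Matrix (Fin (d + 1)) (Fin (d + 1)) F).intEntry i j = 0 := by
  unfold intEntry
  split_ifs with hr
  · exact one_apply_ne (by simp only [ne_eq, Fin.mk.injEq]; lia)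
  · rfl

/-- Left multiplication by a tridiagonal matrix, with integer indices. -/
theorem intEntry_mul_of_tridiagonal
    (hM : ∀ i k, k ≠ i - 1 → k ≠ i → k ≠ i + 1 → M.intEntry i k = 0) (i j : ℤ) :
    (M * N).intEntry i j = M.intEntry i (i - 1) * N.intEntry (i - 1) j
      + M.intEntry i i * N.intEntry i j + M.intEntry i (i + 1) * N.intEntry (i + 1) j := by
  by_cases hi : 0 ≤ i ∧ i ≤ d
  swap
  · have hi' : i < 0 ∨ d < i := by lia
    simp [intEntry_eq_zero_of_row _ hi']
  by_cases hj : 0 ≤ j ∧ j ≤ d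
  swap
  · have h0 (K : Matrix (Fin (d + 1)) (Fin (d + 1)) F) (k : ℤ) : K.intEntry k j = 0 :=
      dif_neg (by lia)
    simp [h0]
  lift i to ℕ using hi.1
  lift j to ℕ using hj.1
  have hi' : i ≤ d := by lia
  have hj' : j ≤ d := by lia
  set f : ℤ → F := fun k => M.intEntry i k * N.intEntry k j with hf
  have e1 : (M * N).intEntry i j = ∑ k ∈ Finset.Icc (0 : ℤ) d, f k := by
    rw [intEntry_natCast _ hi' hj', mul_apply]
    refine Finset.sum_nbij (fun k : Fin (d + 1) => ((k : ℕ) : ℤ)) ?_ ?_ ?_ ?_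
    · intro k _
      have := k.isLt
      simp only [Finset.mem_Icc]
      omega
    · intro k _ l _ h
      simpa [Fin.ext_iff] using h
    · intro k hk
      simp only [Finset.coe_Icc, Set.mem_Icc] at hk
      exact ⟨⟨k.toNat, by lia⟩, by simp, by simp [hk.1]⟩
    · intro k _
      rw [hf]
      exact congrArg₂ _ (intEntry_val M ⟨i, by lia⟩ k).symm (intEntry_val N k ⟨j, by lia⟩).symm
  have e2 : ∑ k ∈ Finset.Icc (0 : ℤ) d, f k = ∑ k ∈ Finset.Icc (-1 : ℤ) (d + 1), f k := by
    refine Finset.sum_subset (fun k => by simp only [Finset.mem_Icc]; lia) ?_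
    intro k _ hk
    simp only [Finset.mem_Icc] at hk
    rw [hf]
    simp only
    rw [intEntry_eq_zero_of_row N (by lia), mul_zero]
  have e3 : ∑ k ∈ ({(i : ℤ) - 1, (i : ℤ), (i : ℤ) + 1} : Finset ℤ), f k
      = ∑ k ∈ Finset.Icc (-1 : ℤ) (d + 1), f k := by
    refine Finset.sum_subset (fun k => ?_) ?_
    · simp only [Finset.mem_Icc, Finset.mem_insert, Finset.mem_singleton]; lia
    · intro k _ hk
      simp only [Finset.mem_insert, Finset.mem_singleton, not_or] at hk
      rw [hf]
      simp only
      rw [hM _ _ hk.1 hk.2.1 hk.2.2, zero_mul]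
  rw [e1, e2, ← e3, Finset.sum_insert (by simp; lia), Finset.sum_insert (by simp),
    Finset.sum_singleton, add_assoc]

end Matrix

set_option maxHeartbeats 1000000 in
/-- Entrywise form of the Askey–Wilson relations for a lower bidiagonal matrix with subdiagonal
entries `1` and a tridiagonal matrix. -/
theorem askeyWilson_entries {F : Type*} [Field F] {d : ℕ} (hd : 1 ≤ d) {θ x y z : ℕ → F}
    {β ρ ρs ω η ηs : F} (hy0 : y 0 = 0) (hyd1 : y (d + 1) = 0)
    {A As : Matrix (Fin (d + 1)) (Fin (d + 1)) F}
    (hA : ∀ i j : Fin (d + 1), A i j =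
      if (i : ℕ) = (j : ℕ) then θ (i : ℕ)
      else if (i : ℕ) = (j : ℕ) + 1 then 1 else 0)
    (hAs : ∀ i j : Fin (d + 1), As i j =
      if (i : ℕ) = (j : ℕ) then x (i : ℕ)
      else if (i : ℕ) = (j : ℕ) + 1 then z (i : ℕ)
      else if (j : ℕ) = (i : ℕ) + 1 then y (j : ℕ) else 0)
    (hAW1 : A ^ 2 * As - β • (A * As * A) + As * A ^ 2 - ρ • As =
      ω • A + η • (1 : Matrix (Fin (d + 1)) (Fin (d + 1)) F))
    (hAW2 : As ^ 2 * A - β • (As * A * As) + A * As ^ 2 - ρs • A =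
      ω • As + ηs • (1 : Matrix (Fin (d + 1)) (Fin (d + 1)) F)) :
    (x 0 * ((2 - β) * θ 0 ^ 2 - ρ) + y 1 * (θ 0 + θ 1 - β * θ 0) = ω * θ 0 + η) ∧
    (∀ i, i + 1 ≤ d → z (i + 1) * (θ i ^ 2 - β * θ i * θ (i + 1) + θ (i + 1) ^ 2 - ρ)
      + x i * (θ i + θ (i + 1) - β * θ i) + x (i + 1) * (θ i + θ (i + 1) - β * θ (i + 1))
      + y i - β * y (i + 1) + y (i + 2) = ω) ∧
    (∀ i, i + 2 ≤ d → z (i + 2) * (θ (i + 1) + θ i - β * θ (i + 2))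
      + z (i + 1) * (θ (i + 2) + θ (i + 1) - β * θ i) + x i - β * x (i + 1) + x (i + 2) = 0) ∧
    (∀ i, i + 1 ≤ d → z (i + 1) * (x i * (θ i + θ (i + 1) - β * θ i)
        + x (i + 1) * (θ i + θ (i + 1) - β * θ (i + 1)))
      + x i ^ 2 - β * x i * x (i + 1) + x (i + 1) ^ 2
      + y i * z i + 2 * (y (i + 1) * z (i + 1)) + y (i + 2) * z (i + 2)
      - β * z (i + 1) * (y i + y (i + 2)) - ρs = ω * z (i + 1)) := by
  have triA : ∀ i k, k ≠ i - 1 → k ≠ i → k ≠ i + 1 → A.intEntry i k = 0 := by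
    intro i k h1 h2 h3
    unfold Matrix.intEntry
    split_ifs with hr
    · rw [hA, if_neg (by simp only; lia), if_neg (by simp only; lia)]
    · rfl
  have triAs : ∀ i k, k ≠ i - 1 → k ≠ i → k ≠ i + 1 → As.intEntry i k = 0 := by
    intro i k h1 h2 h3
    unfold Matrix.intEntry
    split_ifs with hr
    · rw [hAs, if_neg (by simp only; lia), if_neg (by simp only; lia),
        if_neg (by simp only; lia)]
    · rfl
  have mulA (N : Matrix (Fin (d + 1)) (Fin (d + 1)) F) (i j : ℤ) :=
    A.intEntry_mul_of_tridiagonal N triA i j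
  have mulAs (N : Matrix (Fin (d + 1)) (Fin (d + 1)) F) (i j : ℤ) :=
    As.intEntry_mul_of_tridiagonal N triAs i j
  have triA' (i : ℤ) : A.intEntry i (i + 1) = 0 := by
    unfold Matrix.intEntry
    split_ifs with hr
    · rw [hA, if_neg (by simp only; lia), if_neg (by simp only; lia)]
    · rfl
  have entry1 (i j : ℤ) := congrArg (fun M => Matrix.intEntry M i j) hAW1
  have entry2 (i j : ℤ) := congrArg (fun M => Matrix.intEntry M i j) hAW2
  simp only [pow_two, Matrix.mul_assoc, Matrix.intEntry_add, Matrix.intEntry_sub,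
    Matrix.intEntry_smul, mulA, mulAs, triA', zero_mul, add_zero] at entry1 entry2
  have hθ (i : ℕ) (hi : i ≤ d) : A.intEntry i i = θ i := by
    rw [Matrix.intEntry_natCast _ hi hi, hA, if_pos rfl]
  have hn (i : ℕ) (hi : i + 1 ≤ d) : A.intEntry (i + 1) i = 1 := by
    have := Matrix.intEntry_natCast A hi (show i ≤ d by lia)
    push_cast at this
    rw [this, hA, if_neg (by simp), if_pos rfl]
  have hx (i : ℕ) (hi : i ≤ d) : As.intEntry i i = x i := by
    rw [Matrix.intEntry_natCast _ hi hi, hAs, if_pos rfl]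
  have hz (i : ℕ) (hi : i + 1 ≤ d) : As.intEntry (i + 1) i = z (i + 1) := by
    have := Matrix.intEntry_natCast As hi (show i ≤ d by lia)
    push_cast at this
    rw [this, hAs, if_neg (by simp), if_pos rfl]
  have hy (i : ℕ) (hi : i ≤ d) : As.intEntry i (i + 1) = y (i + 1) := by
    rcases hi.eq_or_lt with rfl | hi
    · rw [hyd1]
      exact dif_neg (by lia)
    · have := Matrix.intEntry_natCast As hi.le (show i + 1 ≤ d by lia)
      push_cast at this
      rw [this, hAs, if_neg (by simp), if_neg (by simp only; lia), if_pos rfl]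
  have hy' (i : ℕ) (hi : i ≤ d) : As.intEntry (i - 1) i = y i := by
    rcases i with _ | i
    · rw [hy0]
      exact dif_neg (by lia)
    · simpa using hy i (by lia)
  have yn (i : ℕ) (hi : i ≤ d) :
      y (i + 1) * A.intEntry (i + 1) i = y (i + 1) := by
    rcases hi.eq_or_lt with rfl | hi
    · rw [hyd1, zero_mul]
    · rw [hn i hi, mul_one]
  have yn' (i : ℕ) (hi : i ≤ d) : y i * A.intEntry i (i - 1) = y i := by
    rcases i with _ | i
    · rw [hy0, zero_mul]
    · simpa using yn i (by lia)
  have yz (i : ℕ) (hi : i ≤ d) :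
      y (i + 1) * As.intEntry (i + 1) i = y (i + 1) * z (i + 1) := by
    rcases hi.eq_or_lt with rfl | hi
    · rw [hyd1, zero_mul, zero_mul]
    · rw [hz i hi]
  have yz' (i : ℕ) (hi : i ≤ d) : y i * As.intEntry i (i - 1) = y i * z i := by
    rcases i with _ | i
    · rw [hy0, zero_mul, zero_mul]
    · simpa using yz i (by lia)
  have zA : ∀ i k, k ≠ i - 1 → k ≠ i → A.intEntry i k = 0 := by
    intro i k h1 h2
    by_cases h3 : k = i + 1
    · rw [h3, triA']
    · exact triA i k h1 h2 h3
  have hθ' (i : ℕ) (hi : i + 1 ≤ d) : A.intEntry (i + 1) (i + 1) = θ (i + 1) := by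
    simpa using hθ (i + 1) hi
  have hx' (i : ℕ) (hi : i + 1 ≤ d) : As.intEntry (i + 1) (i + 1) = x (i + 1) := by
    simpa using hx (i + 1) hi
  have hyy (i : ℕ) (hi : i + 1 ≤ d) : As.intEntry (i + 1) (i + 1 + 1) = y (i + 2) := by
    simpa using hy (i + 1) hi
  refine ⟨?_, ?_, ?_, ?_⟩
  · have e := entry1 (0 : ℕ) (0 : ℕ)
    rw [Matrix.intEntry_one_self (by simp) (by simp), hθ 0 (by simp), hx 0 (by simp),
      hy 0 (by simp)] at e
    simp only [add_sub_cancel_right, sub_add_cancel] at e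
    simp (disch := omega) only [zA, triAs, hθ' 0 hd, hθ 0 (Nat.zero_le d)] at e
    have n1 := yn 0 (by lia)
    have n0 := yn' 0 (by lia)
    have h0 : A.intEntry (0 : ℕ) ((0 : ℕ) - 1) = 0 := dif_neg (by lia)
    have h0' : As.intEntry (0 : ℕ) ((0 : ℕ) - 1) = 0 := dif_neg (by lia)
    rw [h0, h0'] at e
    linear_combination e + (-(θ 0 + θ 1 - β * θ 0)) * n1
  · intro i hi
    have e := entry1 ((i : ℤ) + 1) i
    rw [Matrix.intEntry_one_of_ne (by simp)] at e
    simp only [add_sub_cancel_right] at e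
    simp (disch := omega) only [zA] at e
    simp only [hθ i (by lia), hθ' i hi, hx i (by lia), hx' i hi, hy i (by lia), hy' i (by lia),
      hyy i hi, hz i hi, hn i hi] at e
    have n1 := yn (i + 1) (by lia)
    have n0 := yn' i (by lia)
    push_cast at n1
    linear_combination e - n0 - n1
  · intro i hi
    have e := entry1 ((i : ℤ) + 1 + 1) i
    rw [Matrix.intEntry_one_of_ne (by lia)] at e
    have a1 := hn (i + 1) hi
    have a2 := hz (i + 1) hi
    have a3 := hθ' (i + 1) hi
    have a4 := hx' (i + 1) hi
    push_cast at a1 a2 a3 a4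
    simp only [add_sub_cancel_right] at e
    simp (disch := omega) only [zA, triAs] at e
    simp only [hθ i (by lia), hθ' i (by lia), hx i (by lia), hx' i (by lia), hz i (by lia),
      hn i (by lia), a1, a2, a3, a4] at e
    linear_combination e
  · intro i hi
    have e := entry2 ((i : ℤ) + 1) i
    rw [Matrix.intEntry_one_of_ne (by simp)] at e
    simp only [add_sub_cancel_right] at e
    simp (disch := omega) only [zA, triAs] at e
    simp only [hθ i (by lia), hθ' i hi, hx i (by lia), hx' i hi, hy i (by lia), hy' i (by lia),
      hyy i hi, hz i hi, hn i hi] at e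
    have n1 := yn (i + 1) (by lia)
    have n0 := yn' i (by lia)
    have m1 := yz (i + 1) (by lia)
    have m0 := yz' i (by lia)
    push_cast at n1 m1
    linear_combination e + β * z (i + 1) * n1 + β * z (i + 1) * n0 - m0 - m1


/-- stmt19 of the paper, in the Askey–Wilson setting. -/
theorem stmt19 {F : Type*} [Field F] [IsAlgClosed F] {d : ℕ} (hd : 3 ≤ d)
    (q a a' b b' ξ : F) (hq : q ≠ 0)
    (hqru : ∀ n : ℕ, 1 ≤ n → q ^ n ≠ 1)
    (θ : ℤ → F)
    (hθ : ∀ i : ℤ, θ i = a * q ^ (2 * i - (d : ℤ)) + a' * q ^ ((d : ℤ) - 2 * i))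
    (hθdist : ∀ i j : ℕ, i ≤ d → j ≤ d → i ≠ j → θ i ≠ θ j)
    (β ρ ρs ω η ηs : F)
    (hβ : β = q ^ (2 : ℤ) + q ^ (-2 : ℤ))
    (hρ : ρ = -(a * a') * (q ^ (2 : ℤ) - q ^ (-2 : ℤ)) ^ 2)
    (hρs : ρs = -(b * b') * (q ^ (2 : ℤ) - q ^ (-2 : ℤ)) ^ 2)
    (hω : ω = (q - q⁻¹) ^ 2 *
      ((q ^ ((d : ℤ) + 1) + q ^ (-(d : ℤ) - 1)) * ξ - (a + a') * (b + b')))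
    (hη : η = -((q - q⁻¹) * (q ^ (2 : ℤ) - q ^ (-2 : ℤ)) *
      ((a + a') * ξ - a * a' * (b + b') * (q ^ ((d : ℤ) + 1) + q ^ (-(d : ℤ) - 1)))))
    (hηs : ηs = -((q - q⁻¹) * (q ^ (2 : ℤ) - q ^ (-2 : ℤ)) *
      ((b + b') * ξ - b * b' * (a + a') * (q ^ ((d : ℤ) + 1) + q ^ (-(d : ℤ) - 1)))))
    (x y z : ℕ → F)
    (hyz : ∀ i : ℕ, 1 ≤ i → i ≤ d → y i * z i ≠ 0)
    (hy0 : y 0 = 0) (hyd1 : y (d + 1) = 0)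
    (A As : Matrix (Fin (d + 1)) (Fin (d + 1)) F)
    (hA : ∀ i j : Fin (d + 1), A i j =
      if (i : ℕ) = (j : ℕ) then θ (i : ℕ)
      else if (i : ℕ) = (j : ℕ) + 1 then 1 else 0)
    (hAs : ∀ i j : Fin (d + 1), As i j =
      if (i : ℕ) = (j : ℕ) then x (i : ℕ)
      else if (i : ℕ) = (j : ℕ) + 1 then z (i : ℕ)
      else if (j : ℕ) = (i : ℕ) + 1 then y (j : ℕ) else 0)
    (hAW1 : A ^ 2 * As - β • (A * As * A) + As * A ^ 2 - ρ • As =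
      ω • A + η • (1 : Matrix (Fin (d + 1)) (Fin (d + 1)) F))
    (hAW2 : As ^ 2 * A - β • (As * A * As) + A * As ^ 2 - ρs • A =
      ω • As + ηs • (1 : Matrix (Fin (d + 1)) (Fin (d + 1)) F))
    (hz : ∀ i : ℕ, 1 ≤ i → i ≤ d → z i = z 1 * q ^ ((2 : ℤ) - 2 * (i : ℤ)))
    (hne : a ≠ a' * q ^ (2 * (d : ℤ) + 2)) (hne' : a' ≠ a * q ^ (2 * (d : ℤ) + 2)) :
    (∀ i : ℕ, i ≤ d →
      x i = (b + b') * q ^ ((d : ℤ) - 2 * (i : ℤ)) -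
        a' * q ^ (1 - 2 * (i : ℤ)) *
          (q ^ ((d : ℤ) + 1) + q ^ (-(d : ℤ) - 1) - q ^ ((d : ℤ) - 2 * (i : ℤ) - 1) -
            q ^ ((d : ℤ) - 2 * (i : ℤ) + 1)) * z 1) ∧
    (∀ i : ℕ, 1 ≤ i → i ≤ d →
      y i = q ^ ((d : ℤ) - 1) * (q ^ (i : ℤ) - q ^ (-(i : ℤ))) *
        (q ^ ((i : ℤ) - (d : ℤ) - 1) - q ^ ((d : ℤ) - (i : ℤ) + 1)) *
        (b + a' * z 1 * q ^ (2 - 2 * (i : ℤ))) * (b' + a' * z 1 * q ^ (2 - 2 * (i : ℤ))) *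
        (z 1)⁻¹) := by
  have hroot (n : ℕ) (hn : 1 ≤ n) : q ^ n - 1 ≠ 0 := sub_ne_zero.2 (hqru n hn)
  set s : F := q ^ 2 with hs_def
  set D : F := q ^ d with hD_def
  set T : F := s * D ^ 2 with hT_def
  have hs : s ≠ 0 := pow_ne_zero _ hq
  have hD : D ≠ 0 := pow_ne_zero _ hq
  have hs1 : s - 1 ≠ 0 := hroot 2 (by lia)
  have hs2 : s + 1 ≠ 0 := by
    intro h
    apply hroot 4 (by lia)
    linear_combination (s - 1) * h
  have hs3 : s ^ 3 - 1 ≠ 0 := by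
    rw [hs_def, ← pow_mul]
    exact hroot _ (by lia)
  have hTq : T = q ^ (2 * d + 2) := by rw [hT_def, hs_def, hD_def]; ring
  have hTs : T = s ^ (d + 1) := by rw [hTq, hs_def]; ring
  have hT1 : T - 1 ≠ 0 := by
    rw [hTq]
    exact hroot _ (by lia)
  have hT2 : T + 1 ≠ 0 := by
    intro h
    apply hroot (4 * d + 4) (by lia)
    have : q ^ (4 * d + 4) = T ^ 2 := by rw [hTq]; ring
    rw [this]
    linear_combination (T - 1) * h
  have hTz : q ^ (2 * (d : ℤ) + 2) = T := by
    rw [hTq]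
    exact_mod_cast (zpow_natCast q (2 * d + 2))
  rw [hTz] at hne hne'
  set Z : F := z 1 * s with hZ_def
  have hz1 : z 1 ≠ 0 := right_ne_zero_of_mul (hyz 1 le_rfl (by lia))
  have hZ : Z ≠ 0 := mul_ne_zero hz1 hs
  have hθs (i : ℕ) : θ i = a / D * s ^ i + a' * D / s ^ i := by
    rw [hθ, zpow_sub₀ hq, zpow_sub₀ hq, zpow_mul, zpow_natCast, zpow_natCast, hs_def, hD_def]
    norm_cast
    ring
  have hzs (i : ℕ) (h1 : 1 ≤ i) (hi : i ≤ d) : z i = Z / s ^ i := by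
    rw [hz i h1 hi, zpow_sub₀ hq, zpow_mul, zpow_natCast, hZ_def, hs_def]
    norm_cast
    ring
  have hyzs (i : ℕ) (hi : i ≤ d + 1) : y i * z i = y i * (Z / s ^ i) := by
    rcases Nat.eq_zero_or_pos i with rfl | h
    · rw [hy0, zero_mul, zero_mul]
    · rcases hi.eq_or_lt with rfl | h'
      · rw [hyd1, zero_mul, zero_mul]
      · rw [hzs i h (by lia)]
  have hqs : q ^ (2 : ℤ) = s := by rw [hs_def]; norm_cast
  have hqs' : q ^ (-2 : ℤ) = s⁻¹ := by rw [zpow_neg, hqs]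
  have hτ : q ^ ((d : ℤ) + 1) = q * D := by
    rw [zpow_add₀ hq, zpow_natCast, zpow_one, mul_comm]
  have hτ' : q ^ (-(d : ℤ) - 1) = (q * D)⁻¹ := by
    rw [← hτ, ← zpow_neg]; congr 1; ring
  rw [hqs, hqs'] at hβ hρ hρs hη
  rw [hτ, hτ'] at hω hη
  have huv : a / D ≠ 0 ∨ a' * D ≠ 0 := by
    by_contra! h
    apply hθdist 0 1 (by lia) (by lia) (by lia)
    rw [hθs, hθs, h.1, h.2]
    simp
  obtain ⟨E00, Esub, Ediag, ES⟩ :=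
    askeyWilson_entries (θ := fun i : ℕ => θ i) (by lia) hy0 hyd1 hA hAs hAW1 hAW2
  simp only [hθs] at E00 Esub Ediag ES
  obtain ⟨α, γ, hx⟩ := exists_diag_closed_form (u := a / D) (v := a' * D) (Z := Z) (d := d)
    (x := x) hs hs1 hs2 (by
      intro i hi
      have e := Ediag i hi
      rw [hzs _ (by lia) hi, hzs _ (by lia) (by lia), hβ] at e
      exact e)
  have hsub (i : ℕ) (hi : i + 1 ≤ d) :
      x i * ((a / D * s ^ i + a' * D / s ^ i) + (a / D * s ^ (i + 1) + a' * D / s ^ (i + 1))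
          - (s + s⁻¹) * (a / D * s ^ i + a' * D / s ^ i))
        + x (i + 1) * ((a / D * s ^ i + a' * D / s ^ i)
          + (a / D * s ^ (i + 1) + a' * D / s ^ (i + 1))
          - (s + s⁻¹) * (a / D * s ^ (i + 1) + a' * D / s ^ (i + 1)))
        + y i - (s + s⁻¹) * y (i + 1) + y (i + 2) = ω := by
    have h0 : (a / D * s ^ i + a' * D / s ^ i) ^ 2
        - β * (a / D * s ^ i + a' * D / s ^ i) * (a / D * s ^ (i + 1) + a' * D / s ^ (i + 1))
        + (a / D * s ^ (i + 1) + a' * D / s ^ (i + 1)) ^ 2 - ρ = 0 := by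
      rw [hβ, hρ, pow_succ s i]
      have ht : s ^ i ≠ 0 := pow_ne_zero _ hs
      generalize s ^ i = t at *
      field_simp
      ring
    have e := Esub i hi
    rw [h0, mul_zero, zero_add, hβ] at e
    exact e
  obtain ⟨A₁, B, hy⟩ := exists_superdiag_closed_form hs hs1 hs2 hx hsub
  obtain ⟨rfl, hA₁⟩ := leading_coeffs (r := b * b') hs hs1 hs2 hs3 hZ huv hd hx hy (by
    intro i hi
    have e := ES i hi
    rw [hyzs i (by lia), hyzs (i + 1) (by lia), hyzs (i + 2) (by lia), hzs (i + 1) (by lia) hi,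
      hβ, hρs] at e
    have e' := hsub i hi
    have ht : s ^ i ≠ 0 := pow_ne_zero _ hs
    have w0 : Z / s ^ i = Z / s ^ (i + 1) * s := by
      rw [pow_succ]; field_simp
    have w2 : Z / s ^ (i + 2) = Z / s ^ (i + 1) * s⁻¹ := by
      rw [pow_succ _ (i + 1)]; field_simp
    rw [w0, w2] at e
    linear_combination e - Z / s ^ (i + 1) * e')
  obtain ⟨g, rfl⟩ : ∃ g, γ = g * D := ⟨γ / D, by field_simp⟩
  simp only [zero_mul, zero_add, zero_div, add_zero] at hx hy
  obtain ⟨hg, hB, hC⟩ := boundary_coeffs (T := T) (X := ξ / (q * D)) (g := g) (A := A₁) (B := B)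
    (C := -(g * D * (a / D)) - ω * s / (s - 1) ^ 2) (ω := ω) (η := η)
    hs hs1 hs2 hD hT_def hT1 hT2 hZ (sub_ne_zero.2 hne) (sub_ne_zero.2 hne') hA₁
    (by
      rw [hω, hT_def, hs_def]
      field_simp)
    (by
      rw [hη, hT_def, hs_def]
      field_simp
      ring)
    (by field_simp)
    (by
      rw [← hy0, hy 0 (by lia), hT_def]
      ring)
    (by
      rw [← hyd1, hy (d + 1) le_rfl, ← hTs, hT_def]
      ring)
    (by
      rw [hx 0 (by lia), hy 1 (by lia), hβ, hρ] at E00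
      rw [hT_def]
      linear_combination E00)
  have hqz (i : ℕ) : q ^ (2 * (i : ℤ)) = s ^ i := by
    rw [zpow_mul, zpow_natCast, hqs]
  refine ⟨fun i hi => ?_, fun i h1 hi => ?_⟩
  · have e2 : q ^ ((d : ℤ) - 2 * i) = D / s ^ i := by
      rw [zpow_sub₀ hq, hqz, zpow_natCast]
    have e1 : q ^ (1 - 2 * (i : ℤ)) = q / s ^ i := by
      rw [zpow_sub₀ hq, hqz, zpow_one]
    have e3 : q ^ ((d : ℤ) - 2 * i - 1) = D / s ^ i / q := by
      rw [zpow_sub₀ hq, e2, zpow_one]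
    have e4 : q ^ ((d : ℤ) - 2 * i + 1) = D / s ^ i * q := by
      rw [zpow_add₀ hq, e2, zpow_one]
    rw [hx i hi, hg, e1, e2, e3, e4, hτ, hτ', hT_def, hZ_def]
    have ht : s ^ i ≠ 0 := pow_ne_zero _ hs
    generalize s ^ i = t at *
    rw [hs_def]
    field_simp
    ring
  · have hA₁' : A₁ = b * b' / Z := by
      field_simp
      exact hA₁
    have e1 : q ^ ((d : ℤ) - 1) = D / q := by
      rw [zpow_sub₀ hq, zpow_natCast, zpow_one]
    have e2 : q ^ (-(i : ℤ)) = (q ^ i)⁻¹ := by rw [zpow_neg, zpow_natCast]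
    have e3 : q ^ ((i : ℤ) - d - 1) = q ^ i / D / q := by
      rw [zpow_sub₀ hq, zpow_sub₀ hq, zpow_natCast, zpow_natCast, zpow_one]
    have e4 : q ^ ((d : ℤ) - i + 1) = D / q ^ i * q := by
      rw [zpow_add₀ hq, zpow_sub₀ hq, zpow_natCast, zpow_natCast, zpow_one]
    have e5 : q ^ (2 - 2 * (i : ℤ)) = s / (q ^ i) ^ 2 := by
      rw [zpow_sub₀ hq, hqz, hqs, hs_def]
      ring
    have e6 : s ^ i = (q ^ i) ^ 2 := by rw [hs_def]; ring
    rw [hy i (by lia), hC, hB, hg, hA₁', e1, e2, e3, e4, e5, e6, zpow_natCast, hT_def, hZ_def]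
    have ht : q ^ i ≠ 0 := pow_ne_zero _ hq
    generalize q ^ i = t at *
    rw [hs_def]
    field_simp
    ring
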